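/- Let F1 and F2 be sets of nonbasic features with ⁻¹ ∈ F1, ∩ ∈ F1, and ⁻¹ ∉ F2. Then N(F1) is strongly separable from N(F2) at the level of boolean queries; in particular N(F1) ≰bool N(F2). The separating boolean query can be taken to be the one expressed by (R² ∘ R⁻¹ ∘ R) ∩ R. -/

import Mathlib

namespace NavGraph

/-- The nonbasic features of the navigational algebra. -/
inductive Feature : Type
  | di | conv | inter | diff | proj | coproj
  deriving DecidableEq

/-- A graph over the label set `Λ`: it assigns to each label a binary relation
on the infinite universe of nodes (here `ℕ`). -/
def Graph (Λ : Type) : Type := Λ → Set (ℕ × ℕ)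

/-- The active domain of a graph. -/
def adom {Λ : Type} (G : Graph Λ) : Set ℕ :=
  {m | ∃ n : ℕ, ∃ R : Λ, (m, n) ∈ G R ∨ (n, m) ∈ G R}

/-- A graph is finite if each of its relations is finite. -/
def Graph.Finite {Λ : Type} (G : Graph Λ) : Prop := ∀ R : Λ, Set.Finite (G R)

/-- Expressions of the navigational algebra (with all nonbasic features). -/
inductive Expr (Λ : Type) : Type
  | rel (R : Λ)
  | empty
  | id
  | comp (e₁ e₂ : Expr Λ)
  | union (e₁ e₂ : Expr Λ)
  | di
  | conv (e : Expr Λ)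
  | inter (e₁ e₂ : Expr Λ)
  | diff (e₁ e₂ : Expr Λ)
  | proj1 (e : Expr Λ)
  | proj2 (e : Expr Λ)
  | coproj1 (e : Expr Λ)
  | coproj2 (e : Expr Λ)

/-- Semantics of expressions on graphs. -/
def eval {Λ : Type} : Expr Λ → Graph Λ → Set (ℕ × ℕ)
  | .rel R, G => G R
  | .empty, _ => ∅
  | .id, G => {p | p.1 = p.2 ∧ p.1 ∈ adom G}
  | .comp e₁ e₂, G => {p | ∃ z : ℕ, (p.1, z) ∈ eval e₁ G ∧ (z, p.2) ∈ eval e₂ G}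
  | .union e₁ e₂, G => eval e₁ G ∪ eval e₂ G
  | .di, G => {p | p.1 ∈ adom G ∧ p.2 ∈ adom G ∧ p.1 ≠ p.2}
  | .conv e, G => {p | (p.2, p.1) ∈ eval e G}
  | .inter e₁ e₂, G => eval e₁ G ∩ eval e₂ G
  | .diff e₁ e₂, G => eval e₁ G \ eval e₂ G
  | .proj1 e, G => {p | p.1 = p.2 ∧ p.1 ∈ adom G ∧ ∃ n : ℕ, (p.1, n) ∈ eval e G}
  | .proj2 e, G => {p | p.1 = p.2 ∧ p.1 ∈ adom G ∧ ∃ n : ℕ, (n, p.1) ∈ eval e G}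
  | .coproj1 e, G => {p | p.1 = p.2 ∧ p.1 ∈ adom G ∧ ¬ ∃ n : ℕ, (p.1, n) ∈ eval e G}
  | .coproj2 e, G => {p | p.1 = p.2 ∧ p.1 ∈ adom G ∧ ¬ ∃ n : ℕ, (n, p.1) ∈ eval e G}

/-- `e.InFrag F` holds if `e` is an expression of the language `N(F)`, i.e. it
only uses the basic operators and nonbasic features from `F`. -/
def Expr.InFrag {Λ : Type} (F : Set Feature) : Expr Λ → Prop
  | .rel _ => True
  | .empty => True
  | .id => True
  | .comp e₁ e₂ => e₁.InFrag F ∧ e₂.InFrag F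
  | .union e₁ e₂ => e₁.InFrag F ∧ e₂.InFrag F
  | .di => Feature.di ∈ F
  | .conv e => Feature.conv ∈ F ∧ e.InFrag F
  | .inter e₁ e₂ => Feature.inter ∈ F ∧ e₁.InFrag F ∧ e₂.InFrag F
  | .diff e₁ e₂ => Feature.diff ∈ F ∧ e₁.InFrag F ∧ e₂.InFrag F
  | .proj1 e => Feature.proj ∈ F ∧ e.InFrag F
  | .proj2 e => Feature.proj ∈ F ∧ e.InFrag F
  | .coproj1 e => Feature.coproj ∈ F ∧ e.InFrag F
  | .coproj2 e => Feature.coproj ∈ F ∧ e.InFrag F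

/-- Membership in the closure `F̄` of a set of nonbasic features. -/
inductive InClosure (F : Set Feature) : Feature → Prop
  | base {x : Feature} : x ∈ F → InClosure F x
  | proj_of_coproj : InClosure F .coproj → InClosure F .proj
  | proj_of_inter_di : InClosure F .inter → InClosure F .di → InClosure F .proj
  | proj_of_inter_conv : InClosure F .inter → InClosure F .conv → InClosure F .proj
  | coproj_of_diff_proj : InClosure F .diff → InClosure F .proj → InClosure F .coproj
  | inter_of_diff : InClosure F .diff → InClosure F .inter

/-- The closure `F̄` of a set of nonbasic features. -/
def closure (F : Set Feature) : Set Feature := {x | InClosure F x}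

open Classical in
/-- The set `F̃`: replace converse by projection when converse is available but
intersection is not. -/
noncomputable def tilde (F : Set Feature) : Set Feature :=
  if Feature.conv ∈ closure F ∧ Feature.inter ∉ closure F then
    (F \ {Feature.conv}) ∪ {Feature.proj}
  else F

/-- `N(F₁) ≤path N(F₂)`: every path query expressible in `N(F₁)` is expressible
in `N(F₂)`. -/
def leqPath (Λ : Type) (F₁ F₂ : Set Feature) : Prop :=
  ∀ e₁ : Expr Λ, e₁.InFrag F₁ →
    ∃ e₂ : Expr Λ, e₂.InFrag F₂ ∧ ∀ G : Graph Λ, eval e₂ G = eval e₁ G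

/-- `N(F₁) ≤bool N(F₂)`: every boolean query expressible in `N(F₁)` is
expressible in `N(F₂)`. -/
def leqBool (Λ : Type) (F₁ F₂ : Set Feature) : Prop :=
  ∀ e₁ : Expr Λ, e₁.InFrag F₁ →
    ∃ e₂ : Expr Λ, e₂.InFrag F₂ ∧
      ∀ G : Graph Λ, ((eval e₂ G).Nonempty ↔ (eval e₁ G).Nonempty)

/-- Strong separability at the level of boolean queries. -/
def StrongSepBool (Λ : Type) (F₁ F₂ : Set Feature) : Prop :=
  ∃ (e₁ : Expr Λ) (G₁ G₂ : Graph Λ), e₁.InFrag F₁ ∧ G₁.Finite ∧ G₂.Finite ∧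
    (eval e₁ G₁).Nonempty ∧ ¬ (eval e₁ G₂).Nonempty ∧
    ∀ e₂ : Expr Λ, e₂.InFrag F₂ → ((eval e₂ G₁).Nonempty ↔ (eval e₂ G₂).Nonempty)

/-- Strong separability at the level of path queries. -/
def StrongSepPath (Λ : Type) (F₁ F₂ : Set Feature) : Prop :=
  ∃ (e₁ : Expr Λ) (G : Graph Λ), e₁.InFrag F₁ ∧ G.Finite ∧
    ∀ e₂ : Expr Λ, e₂.InFrag F₂ → eval e₂ G ≠ eval e₁ G

/-- The `n`-fold composition `R ∘ ⋯ ∘ R` (with `R⁰ = id`). -/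
def rpow {Λ : Type} (R : Λ) : ℕ → Expr Λ
  | 0 => .id
  | n + 1 => .comp (.rel R) (rpow R n)

/-- The degree of an expression: the maximum depth of nested applications of
composition, projection and coprojection. -/
def degree {Λ : Type} : Expr Λ → ℕ
  | .rel _ => 0
  | .empty => 0
  | .id => 0
  | .di => 0
  | .comp e₁ e₂ => max (degree e₁) (degree e₂) + 1
  | .union e₁ e₂ => max (degree e₁) (degree e₂)
  | .conv e => degree e
  | .inter e₁ e₂ => max (degree e₁) (degree e₂)
  | .diff e₁ e₂ => max (degree e₁) (degree e₂)
  | .proj1 e => degree e + 1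
  | .proj2 e => degree e + 1
  | .coproj1 e => degree e + 1
  | .coproj2 e => degree e + 1

end NavGraph

namespace NavGraph

/-- Every expression evaluates to a relation on the active domain. -/
theorem mem_adom_of_mem_eval {Λ : Type} (G : Graph Λ) (e : Expr Λ) :
    ∀ p q : ℕ, (p, q) ∈ eval e G → p ∈ adom G ∧ q ∈ adom G := by
  induction e with
  | rel R => exact fun p q h => ⟨⟨q, R, Or.inl h⟩, ⟨p, R, Or.inr h⟩⟩
  | empty => exact fun p q h => h.elim
  | di => exact fun p q h => ⟨h.1, h.2.1⟩
  | comp e₁ e₂ ih₁ ih₂ =>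
    rintro p q ⟨z, h₁, h₂⟩
    exact ⟨(ih₁ _ _ h₁).1, (ih₂ _ _ h₂).2⟩
  | union e₁ e₂ ih₁ ih₂ => exact fun p q h => h.elim (ih₁ p q) (ih₂ p q)
  | conv e ih => exact fun p q h => (ih q p h).symm
  | inter e₁ e₂ ih₁ _ => exact fun p q h => ih₁ p q h.1
  | diff e₁ e₂ ih₁ _ => exact fun p q h => ih₁ p q h.1
  | id =>
    rintro p q ⟨hpq : p = q, h⟩
    exact ⟨h, hpq ▸ h⟩
  | proj1 e _ | proj2 e _ | coproj1 e _ | coproj2 e _ =>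
    rintro p q ⟨hpq : p = q, h, -⟩
    exact ⟨h, hpq ▸ h⟩

/-- A simulation between pairs of nodes of two graphs: related pairs agree on edges and on
equality, and any intermediate node for one pair is matched by one for the other. The relation
need not be invariant under swapping the components of the pairs. -/
structure IsPairSimulation {Λ : Type} (G₁ G₂ : Graph Λ) (Z : ℕ → ℕ → ℕ → ℕ → Prop) : Prop where
  rel_iff : ∀ {p q p' q'}, Z p q p' q' → ∀ R : Λ, (p, q) ∈ G₁ R ↔ (p', q') ∈ G₂ R
  eq_iff : ∀ {p q p' q'}, Z p q p' q' → (p = q ↔ p' = q')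
  mem_left : ∀ {p q p' q'}, Z p q p' q' → p ∈ adom G₁ ∧ p' ∈ adom G₂
  mem_right : ∀ {p q p' q'}, Z p q p' q' → q ∈ adom G₁ ∧ q' ∈ adom G₂
  forth : ∀ {p q p' q'}, Z p q p' q' → ∀ z ∈ adom G₁, ∃ z', Z p z p' z' ∧ Z z q z' q'
  total : ∀ p ∈ adom G₁, ∀ q ∈ adom G₁, ∃ p' q', Z p q p' q'

/-- Pairs related by a simulation in both directions satisfy the same converse-free
expressions. -/
theorem IsPairSimulation.mem_eval_iff {Λ : Type} {G₁ G₂ : Graph Λ} {Z : ℕ → ℕ → ℕ → ℕ → Prop}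
    (h : IsPairSimulation G₁ G₂ Z) (h' : IsPairSimulation G₂ G₁ fun p q p' q' => Z p' q' p q)
    {F : Set Feature} (hF : Feature.conv ∉ F) (e : Expr Λ) (he : e.InFrag F) :
    ∀ p q p' q' : ℕ, Z p q p' q' → ((p, q) ∈ eval e G₁ ↔ (p', q') ∈ eval e G₂) := by
  have left_iff : ∀ e : Expr Λ,
      (∀ p q p' q' : ℕ, Z p q p' q' → ((p, q) ∈ eval e G₁ ↔ (p', q') ∈ eval e G₂)) →
      ∀ p q p' q' : ℕ, Z p q p' q' →
        ((∃ n, (p, n) ∈ eval e G₁) ↔ ∃ n, (p', n) ∈ eval e G₂) := by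
    intro e ih p q p' q' hZ
    constructor
    · rintro ⟨n, hn⟩
      obtain ⟨n', hZ', -⟩ := h.forth hZ n (mem_adom_of_mem_eval _ _ _ _ hn).2
      exact ⟨n', (ih _ _ _ _ hZ').1 hn⟩
    · rintro ⟨n, hn⟩
      obtain ⟨n', hZ', -⟩ := h'.forth hZ n (mem_adom_of_mem_eval _ _ _ _ hn).2
      exact ⟨n', (ih _ _ _ _ hZ').2 hn⟩
  have right_iff : ∀ e : Expr Λ,
      (∀ p q p' q' : ℕ, Z p q p' q' → ((p, q) ∈ eval e G₁ ↔ (p', q') ∈ eval e G₂)) →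
      ∀ p q p' q' : ℕ, Z p q p' q' →
        ((∃ n, (n, q) ∈ eval e G₁) ↔ ∃ n, (n, q') ∈ eval e G₂) := by
    intro e ih p q p' q' hZ
    constructor
    · rintro ⟨n, hn⟩
      obtain ⟨n', -, hZ'⟩ := h.forth hZ n (mem_adom_of_mem_eval _ _ _ _ hn).1
      exact ⟨n', (ih _ _ _ _ hZ').1 hn⟩
    · rintro ⟨n, hn⟩
      obtain ⟨n', -, hZ'⟩ := h'.forth hZ n (mem_adom_of_mem_eval _ _ _ _ hn).1
      exact ⟨n', (ih _ _ _ _ hZ').2 hn⟩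
  have diag_iff : ∀ (A : ℕ → Prop) (B : ℕ → Prop),
      (∀ p q p' q' : ℕ, Z p q p' q' → p = q → p' = q' → (A p ↔ B p')) →
      ∀ p q p' q' : ℕ, Z p q p' q' →
        ((p = q ∧ p ∈ adom G₁ ∧ A p) ↔ (p' = q' ∧ p' ∈ adom G₂ ∧ B p')) := by
    intro A B hAB p q p' q' hZ
    constructor
    · rintro ⟨hpq, -, hA⟩
      have hpq' := (h.eq_iff hZ).1 hpq
      exact ⟨hpq', (h.mem_left hZ).2, (hAB _ _ _ _ hZ hpq hpq').1 hA⟩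
    · rintro ⟨hpq', -, hB⟩
      have hpq := (h.eq_iff hZ).2 hpq'
      exact ⟨hpq, (h.mem_left hZ).1, (hAB _ _ _ _ hZ hpq hpq').2 hB⟩
  induction e with
  | rel R => exact fun p q p' q' hZ => h.rel_iff hZ R
  | empty => exact fun p q p' q' _ => Iff.rfl
  | id =>
    exact fun p q p' q' hZ =>
      and_congr (h.eq_iff hZ) (iff_of_true (h.mem_left hZ).1 (h.mem_left hZ).2)
  | di =>
    exact fun p q p' q' hZ =>
      and_congr (iff_of_true (h.mem_left hZ).1 (h.mem_left hZ).2)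
        (and_congr (iff_of_true (h.mem_right hZ).1 (h.mem_right hZ).2) (not_congr (h.eq_iff hZ)))
  | conv e _ => exact absurd he.1 hF
  | comp e₁ e₂ ih₁ ih₂ =>
    intro p q p' q' hZ
    constructor
    · rintro ⟨z, hz₁, hz₂⟩
      obtain ⟨z', hZ₁, hZ₂⟩ := h.forth hZ z (mem_adom_of_mem_eval _ _ _ _ hz₁).2
      exact ⟨z', (ih₁ he.1 _ _ _ _ hZ₁).1 hz₁, (ih₂ he.2 _ _ _ _ hZ₂).1 hz₂⟩
    · rintro ⟨z, hz₁, hz₂⟩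
      obtain ⟨z', hZ₁, hZ₂⟩ := h'.forth hZ z (mem_adom_of_mem_eval _ _ _ _ hz₁).2
      exact ⟨z', (ih₁ he.1 _ _ _ _ hZ₁).2 hz₁, (ih₂ he.2 _ _ _ _ hZ₂).2 hz₂⟩
  | union e₁ e₂ ih₁ ih₂ =>
    exact fun p q p' q' hZ => or_congr (ih₁ he.1 _ _ _ _ hZ) (ih₂ he.2 _ _ _ _ hZ)
  | inter e₁ e₂ ih₁ ih₂ =>
    exact fun p q p' q' hZ => and_congr (ih₁ he.2.1 _ _ _ _ hZ) (ih₂ he.2.2 _ _ _ _ hZ)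
  | diff e₁ e₂ ih₁ ih₂ =>
    exact fun p q p' q' hZ =>
      and_congr (ih₁ he.2.1 _ _ _ _ hZ) (not_congr (ih₂ he.2.2 _ _ _ _ hZ))
  | proj1 e ih =>
    exact diag_iff _ _ fun p q p' q' hZ _ _ => left_iff e (ih he.2) p q p' q' hZ
  | coproj1 e ih =>
    exact diag_iff _ _ fun p q p' q' hZ _ _ => not_congr (left_iff e (ih he.2) p q p' q' hZ)
  | proj2 e ih =>
    refine diag_iff (fun p => ∃ n, (n, p) ∈ eval e G₁) (fun p => ∃ n, (n, p) ∈ eval e G₂)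
      fun p q p' q' hZ hpq hpq' => ?_
    subst hpq hpq'
    exact right_iff e (ih he.2) _ _ _ _ hZ
  | coproj2 e ih =>
    refine diag_iff (fun p => ¬ ∃ n, (n, p) ∈ eval e G₁) (fun p => ¬ ∃ n, (n, p) ∈ eval e G₂)
      fun p q p' q' hZ hpq hpq' => not_congr ?_
    subst hpq hpq'
    exact right_iff e (ih he.2) _ _ _ _ hZ

/-- Graphs that simulate each other agree on all converse-free boolean queries. -/
theorem IsPairSimulation.nonempty_iff {Λ : Type} {G₁ G₂ : Graph Λ} {Z : ℕ → ℕ → ℕ → ℕ → Prop}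
    (h : IsPairSimulation G₁ G₂ Z) (h' : IsPairSimulation G₂ G₁ fun p q p' q' => Z p' q' p q)
    {F : Set Feature} (hF : Feature.conv ∉ F) (e : Expr Λ) (he : e.InFrag F) :
    (eval e G₁).Nonempty ↔ (eval e G₂).Nonempty := by
  constructor
  · rintro ⟨⟨p, q⟩, hpq⟩
    have hm := mem_adom_of_mem_eval _ _ _ _ hpq
    obtain ⟨p', q', hZ⟩ := h.total p hm.1 q hm.2
    exact ⟨(p', q'), (h.mem_eval_iff h' hF e he _ _ _ _ hZ).1 hpq⟩
  · rintro ⟨⟨p, q⟩, hpq⟩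
    have hm := mem_adom_of_mem_eval _ _ _ _ hpq
    obtain ⟨p', q', hZ⟩ := h'.total p hm.1 q hm.2
    exact ⟨(p', q'), (h.mem_eval_iff h' hF e he _ _ _ _ hZ).2 hpq⟩

/-- The nodes `0, …, 9` form five layers `A, X, Y, B, C` of two nodes each, the layer of `n` being
`n / 2`. Nodes of the layer pairs `AX, AY, AB, XY, CB, CY` are linked if they have equal parity,
except that for `CY` and `twist = true` they are linked if they have distinct parity. -/
def linked (twist : Bool) (p q : ℕ) : Bool :=
  match p / 2, q / 2 with
  | 0, 1 | 0, 2 | 0, 3 | 1, 2 | 4, 3 => p % 2 == q % 2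
  | 4, 2 => (p % 2 == q % 2) ^^ twist
  | _, _ => false

/-- The edges: linked pairs, except those from layer `A` to layer `Y`. -/
def edge (twist : Bool) (p q : ℕ) : Bool := linked twist p q && !(p / 2 == 0 && q / 2 == 2)

/-- The graph with edges `edge twist` on the nodes `0, …, 9`, for every label. -/
def layered (Λ : Type) (twist : Bool) : Graph Λ :=
  fun _ => {p | p.1 < 10 ∧ p.2 < 10 ∧ edge twist p.1 p.2 = true}

/-- Two pairs of nodes have the same type if they agree on layers, equality and linkedness. -/
def SameType (s t : Bool) (p q p' q' : ℕ) : Prop :=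
  p < 10 ∧ q < 10 ∧ p' < 10 ∧ q' < 10 ∧ p / 2 = p' / 2 ∧ q / 2 = q' / 2 ∧ (p = q ↔ p' = q') ∧
    linked s p q = linked t p' q'

theorem SameType.symm {s t : Bool} {p q p' q' : ℕ} (h : SameType s t p q p' q') :
    SameType t s p' q' p q := by
  obtain ⟨h₁, h₂, h₃, h₄, h₅, h₆, h₇, h₈⟩ := h
  exact ⟨h₃, h₄, h₁, h₂, h₅.symm, h₆.symm, h₇.symm, h₈.symm⟩

instance (s t : Bool) (p q p' q' : ℕ) : Decidable (SameType s t p q p' q') := by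
  unfold SameType; infer_instance

theorem mem_adom_layered {Λ : Type} (R : Λ) (t : Bool) (n : ℕ) :
    n ∈ adom (layered Λ t) ↔ n < 10 := by
  constructor
  · rintro ⟨m, S, h | h⟩
    · exact h.1
    · exact h.2.1
  · intro hn
    have key : ∀ t : Bool, ∀ n < 10, ∃ m < 10, edge t n m = true ∨ edge t m n = true := by
      decide
    obtain ⟨m, hm, h | h⟩ := key t n hn
    · exact ⟨m, R, Or.inl ⟨hn, hm, h⟩⟩
    · exact ⟨m, R, Or.inr ⟨hm, hn, h⟩⟩

theorem SameType.exists_middle {s t : Bool} {p q p' q' : ℕ} (h : SameType s t p q p' q') (z : ℕ)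
    (hz : z < 10) : ∃ z', SameType s t p z p' z' ∧ SameType s t z q z' q' := by
  have key : ∀ s t : Bool, ∀ a b : Fin 5, ∀ i j i' j' : Fin 2,
      SameType s t (2 * a + i) (2 * b + j) (2 * a + i') (2 * b + j') →
      ∀ (c : Fin 5) (k : Fin 2), ∃ k' : Fin 2,
        SameType s t (2 * a + i) (2 * c + k) (2 * a + i') (2 * c + k') ∧
        SameType s t (2 * c + k) (2 * b + j) (2 * c + k') (2 * b + j') := by
    decide +kernel
  have h₀ := h
  obtain ⟨h₁, h₂, h₃, h₄, h₅, h₆, -, -⟩ := h₀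
  have hp := Nat.div_add_mod p 2
  have hq := Nat.div_add_mod q 2
  have hp' := Nat.div_add_mod p' 2
  have hq' := Nat.div_add_mod q' 2
  rw [← h₅] at hp'
  rw [← h₆] at hq'
  obtain ⟨k', hk'⟩ := key s t ⟨p / 2, by omega⟩ ⟨q / 2, by omega⟩ ⟨p % 2, by omega⟩
    ⟨q % 2, by omega⟩ ⟨p' % 2, by omega⟩ ⟨q' % 2, by omega⟩ (by rwa [hp, hq, hp', hq'])
    ⟨z / 2, by omega⟩ ⟨z % 2, by omega⟩
  rw [hp, hq, hp', hq', Nat.div_add_mod] at hk'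
  exact ⟨_, hk'⟩

theorem exists_sameType (s t : Bool) :
    ∀ p < 10, ∀ q < 10, ∃ p' < 10, ∃ q' < 10, SameType s t p q p' q' := by
  revert s t
  decide +kernel

theorem isPairSimulation_layered {Λ : Type} (R : Λ) (s t : Bool) :
    IsPairSimulation (layered Λ s) (layered Λ t) (SameType s t) where
  rel_iff := by
    rintro p q p' q' ⟨h₁, h₂, h₃, h₄, h₅, h₆, -, h₈⟩ S
    simp only [layered, edge, Set.mem_ofPred_eq, h₁, h₂, h₃, h₄, h₅, h₆, h₈]
  eq_iff h := h.2.2.2.2.2.2.1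
  mem_left h := ⟨(mem_adom_layered R s _).2 h.1, (mem_adom_layered R t _).2 h.2.2.1⟩
  mem_right h := ⟨(mem_adom_layered R s _).2 h.2.1, (mem_adom_layered R t _).2 h.2.2.2.1⟩
  forth h z hz := h.exists_middle z ((mem_adom_layered R s z).1 hz)
  total p hp q hq := by
    obtain ⟨p', -, q', -, h⟩ :=
      exists_sameType s t p ((mem_adom_layered R s p).1 hp) q ((mem_adom_layered R s q).1 hq)
    exact ⟨p', q', h⟩

theorem finite_layered (Λ : Type) (t : Bool) : (layered Λ t).Finite := fun _ =>
  ((Set.finite_Iio 10).prod (Set.finite_Iio 10)).subset fun _ h => ⟨h.1, h.2.1⟩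

theorem mem_eval_separating_iff {Λ : Type} (R : Λ) (G : Graph Λ) (a b : ℕ) :
    (a, b) ∈ eval (Expr.inter (.comp (rpow R 2) (.comp (.conv (.rel R)) (rpow R 1))) (.rel R)) G ↔
      (a, b) ∈ G R ∧
        ∃ x y c, (a, x) ∈ G R ∧ (x, y) ∈ G R ∧ (c, y) ∈ G R ∧ (c, b) ∈ G R := by
  constructor
  · rintro ⟨⟨y, ⟨x, hx, y', hy, hy' : y' = y, -⟩, c, hc, b', hb, hb' : b' = b, -⟩, hab⟩
    subst hy' hb'
    exact ⟨hab, x, y', c, hx, hy, hc, hb⟩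
  · rintro ⟨hab, x, y, c, hx, hy, hc, hb⟩
    exact ⟨⟨y, ⟨x, hx, y, hy, rfl, x, R, Or.inr hy⟩, c, hc, b, hb, rfl, a, R, Or.inr hab⟩, hab⟩

theorem nonempty_eval_separating_layered_false {Λ : Type} (R : Λ) :
    (eval (Expr.inter (.comp (rpow R 2) (.comp (.conv (.rel R)) (rpow R 1))) (.rel R))
      (layered Λ false)).Nonempty := by
  refine ⟨(0, 6), (mem_eval_separating_iff R _ _ _).2 ⟨?_, 2, 4, 8, ?_, ?_, ?_, ?_⟩⟩ <;>
    exact ⟨by decide, by decide, by decide⟩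

theorem eval_separating_layered_true {Λ : Type} (R : Λ) :
    eval (Expr.inter (.comp (rpow R 2) (.comp (.conv (.rel R)) (rpow R 1))) (.rel R))
      (layered Λ true) = ∅ := by
  have key : ∀ a b : Fin 10, edge true a b = true → ∀ x : Fin 10, edge true a x = true →
      ∀ y : Fin 10, edge true x y = true → ∀ c : Fin 10, edge true c y = true →
        ¬ edge true c b = true := by
    decide +kernel
  refine Set.eq_empty_of_forall_notMem ?_
  rintro ⟨a, b⟩ h
  obtain ⟨hab, x, y, c, hx, hy, hc, hb⟩ := (mem_eval_separating_iff R _ _ _).1 h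
  exact key ⟨a, hab.1⟩ ⟨b, hab.2.1⟩ hab.2.2 ⟨x, hx.2.1⟩ hx.2.2 ⟨y, hy.2.1⟩ hy.2.2 ⟨c, hc.1⟩ hc.2.2
    hb.2.2

/-- if `⁻¹ ∈ F₁`, `∩ ∈ F₁` and `⁻¹ ∉ F₂`, then `N(F₁)` is
strongly separable from `N(F₂)` at the level of boolean queries; the separating
boolean query can be taken to be the one expressed by `(R² ∘ R⁻¹ ∘ R) ∩ R`. -/
theorem conv_inter_separation (Λ : Type) [Fintype Λ] [Nonempty Λ] (R : Λ)
    (F₁ F₂ : Set Feature) (h₁ : Feature.conv ∈ F₁) (h₂ : Feature.inter ∈ F₁)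
    (h₃ : Feature.conv ∉ F₂) :
    (Expr.inter (.comp (rpow R 2) (.comp (.conv (.rel R)) (rpow R 1)))
      (.rel R)).InFrag F₁ ∧
    (∃ G₁ G₂ : Graph Λ, G₁.Finite ∧ G₂.Finite ∧
      (eval (Expr.inter (.comp (rpow R 2) (.comp (.conv (.rel R)) (rpow R 1)))
        (.rel R)) G₁).Nonempty ∧
      eval (Expr.inter (.comp (rpow R 2) (.comp (.conv (.rel R)) (rpow R 1)))
        (.rel R)) G₂ = ∅ ∧
      (∀ e₂ : Expr Λ, e₂.InFrag F₂ →
        ((eval e₂ G₁).Nonempty ↔ (eval e₂ G₂).Nonempty))) ∧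
    StrongSepBool Λ F₁ F₂ ∧ ¬ leqBool Λ F₁ F₂ := by
  have hfrag : (Expr.inter (.comp (rpow R 2) (.comp (.conv (.rel R)) (rpow R 1)))
      (.rel R)).InFrag F₁ := by
    simp [Expr.InFrag, rpow, h₁, h₂]
  have hequiv : ∀ e : Expr Λ, e.InFrag F₂ →
      ((eval e (layered Λ false)).Nonempty ↔ (eval e (layered Λ true)).Nonempty) := by
    refine (isPairSimulation_layered R false true).nonempty_iff ?_ h₃
    convert isPairSimulation_layered R true false using 5
    exact ⟨SameType.symm, SameType.symm⟩
  have hne := nonempty_eval_separating_layered_false R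
  have hempty := eval_separating_layered_true R
  refine ⟨hfrag, ⟨_, _, finite_layered Λ false, finite_layered Λ true, hne, hempty, hequiv⟩,
    ⟨_, _, _, hfrag, finite_layered Λ false, finite_layered Λ true, hne,
      Set.not_nonempty_iff_eq_empty.2 hempty, hequiv⟩, fun hle => ?_⟩
  obtain ⟨e, he, h⟩ := hle _ hfrag
  exact Set.not_nonempty_iff_eq_empty.2 hempty ((h _).1 ((hequiv e he).1 ((h _).2 hne)))

end NavGraph
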